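/- arXiv:1002.1110 — 3 statements merged into one kernel-verified Lean document; each statement's English description precedes it below -/
import Mathlib

section
/- Let Ω ⊂ ℝ² be open, let p and q be real-valued functions on Ω with p twice continuously differentiable and p > 0 on Ω, let u₀ be a positive twice continuously differentiable solution of div(p grad u₀) + q u₀ = 0 on Ω, and let u be a real-valued twice continuously differentiable solution of div(p grad u) + q u = 0 on Ω. Define the complex-valued function Φ = i·p·u₀²·∂_z̄(u₀^{−1} u) and write Φ = Φ₁ + iΦ₂ with Φ₁, Φ₂ real-valued. Then Φ satisfies the compatibility condition ∂_y Φ₁ − ∂_x Φ₂ = 0 on Ω. -/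
open Complex

/-- Partial derivative in `x` of a complex-valued function on `ℝ²`. -/
noncomputable def pdx (f : ℝ × ℝ → ℂ) (z : ℝ × ℝ) : ℂ := fderiv ℝ f z (1, 0)

/-- Partial derivative in `y` of a complex-valued function on `ℝ²`. -/
noncomputable def pdy (f : ℝ × ℝ → ℂ) (z : ℝ × ℝ) : ℂ := fderiv ℝ f z (0, 1)

/-- The Wirtinger derivative `∂_z̄ = ½(∂_x + i∂_y)`. -/
noncomputable def dzbar (f : ℝ × ℝ → ℂ) (z : ℝ × ℝ) : ℂ :=
  (1 / 2 : ℂ) * (pdx f z + Complex.I * pdy f z)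

/-- The Wirtinger derivative `∂_z = ½(∂_x − i∂_y)`. -/
noncomputable def dz (f : ℝ × ℝ → ℂ) (z : ℝ × ℝ) : ℂ :=
  (1 / 2 : ℂ) * (pdx f z - Complex.I * pdy f z)

/-- Partial derivative in `x` of a real-valued function on `ℝ²`. -/
noncomputable def rpdx (f : ℝ × ℝ → ℝ) (z : ℝ × ℝ) : ℝ := fderiv ℝ f z (1, 0)

/-- Partial derivative in `y` of a real-valued function on `ℝ²`. -/
noncomputable def rpdy (f : ℝ × ℝ → ℝ) (z : ℝ × ℝ) : ℝ := fderiv ℝ f z (0, 1)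

/-- `div(p grad u) = ∂_x(p ∂_x u) + ∂_y(p ∂_y u)`. -/
noncomputable def divPgrad (p u : ℝ × ℝ → ℝ) (z : ℝ × ℝ) : ℝ :=
  rpdx (fun w => p w * rpdx u w) z + rpdy (fun w => p w * rpdy u w) z

/-- Coercion of a real-valued function on `ℝ²` to a complex-valued one. -/
noncomputable def cof (f : ℝ × ℝ → ℝ) : ℝ × ℝ → ℂ := fun z => ((f z : ℝ) : ℂ)

/-- Quotient rule for a directional derivative, cleared of denominators. -/
theorem mul_sq_mul_fderiv_inv_mul {p f g : ℝ × ℝ → ℝ} {w : ℝ × ℝ} (v : ℝ × ℝ)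
    (hf : DifferentiableAt ℝ f w) (hg : DifferentiableAt ℝ g w) (hf0 : f w ≠ 0) :
    p w * f w ^ 2 * fderiv ℝ (fun y => (f y)⁻¹ * g y) w v =
      f w * (p w * fderiv ℝ g w v) - g w * (p w * fderiv ℝ f w v) := by
  have hinv : HasFDerivAt (fun y => (f y)⁻¹) (-(f w ^ 2)⁻¹ • fderiv ℝ f w) w :=
    (hasDerivAt_inv hf0).comp_hasFDerivAt w hf.hasFDerivAt
  rw [(hinv.fun_mul hg.hasFDerivAt).fderiv]
  simp
  field_simp
  ring

/-- The directional derivative of the flux `f (p ∂ᵥg) - g (p ∂ᵥf)`. -/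
theorem fderiv_flux {p f g : ℝ × ℝ → ℝ} {z : ℝ × ℝ} (v : ℝ × ℝ)
    (hp : DifferentiableAt ℝ p z) (hf : ContDiffAt ℝ 2 f z) (hg : ContDiffAt ℝ 2 g z) (c : ℝ) :
    fderiv ℝ (fun w => c * (f w * (p w * fderiv ℝ g w v) - g w * (p w * fderiv ℝ f w v))) z v =
      c * (f z * fderiv ℝ (fun w => p w * fderiv ℝ g w v) z v -
        g z * fderiv ℝ (fun w => p w * fderiv ℝ f w v) z v) := by
  have flux_diff : ∀ {h : ℝ × ℝ → ℝ}, ContDiffAt ℝ 2 h z →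
      DifferentiableAt ℝ (fun w => p w * fderiv ℝ h w v) z := fun hh =>
    hp.fun_mul (((hh.fderiv_right (m := 1) (by norm_num)).differentiableAt
      (by norm_num)).clm_apply (differentiableAt_const v))
  have hfd := hf.differentiableAt (by norm_num)
  have hgd := hg.differentiableAt (by norm_num)
  rw [(((hfd.hasFDerivAt.fun_mul (flux_diff hg).hasFDerivAt).fun_sub
    (hgd.hasFDerivAt.fun_mul (flux_diff hf).hasFDerivAt)).const_mul c).fderiv]
  simp [-mul_eq_mul_left_iff]
  ring

theorem fderiv_cof_apply {f : ℝ × ℝ → ℝ} {w : ℝ × ℝ} (hf : DifferentiableAt ℝ f w) (v : ℝ × ℝ) :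
    fderiv ℝ (cof f) w v = ((fderiv ℝ f w v : ℝ) : ℂ) := by
  have h : HasFDerivAt (cof f) (Complex.ofRealCLM.comp (fderiv ℝ f w)) w :=
    Complex.ofRealCLM.hasFDerivAt.comp w hf.hasFDerivAt
  rw [h.fderiv]
  simp

/-- for `u` a solution of `div(p grad u) + qu = 0` and `u₀` a positive solution
of the same equation, the function `Φ = i·p·u₀²·∂_z̄(u₀^{−1}u) = Φ₁ + iΦ₂` satisfies the
compatibility condition `∂_y Φ₁ − ∂_x Φ₂ = 0` on `Ω`. -/
theorem statement5 (Ω : Set (ℝ × ℝ)) (hΩ : IsOpen Ω)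
    (p q u₀ : ℝ × ℝ → ℝ)
    (hp : ContDiffOn ℝ 2 p Ω) (hppos : ∀ z ∈ Ω, 0 < p z)
    (hu₀ : ContDiffOn ℝ 2 u₀ Ω) (hu₀pos : ∀ z ∈ Ω, 0 < u₀ z)
    (hu₀sol : ∀ z ∈ Ω, divPgrad p u₀ z + q z * u₀ z = 0)
    (u : ℝ × ℝ → ℝ) (hu : ContDiffOn ℝ 2 u Ω)
    (husol : ∀ z ∈ Ω, divPgrad p u z + q z * u z = 0)
    (Φ : ℝ × ℝ → ℂ)
    (hΦ : ∀ w, Φ w = Complex.I * (p w : ℂ) * ((u₀ w : ℂ)) ^ 2 *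
      dzbar (cof (fun v => (u₀ v)⁻¹ * u v)) w) :
    ∀ z ∈ Ω, rpdy (fun w => (Φ w).re) z - rpdx (fun w => (Φ w).im) z = 0 := by
  intro z hz
  have hcd : ∀ {f : ℝ × ℝ → ℝ}, ContDiffOn ℝ 2 f Ω → ∀ {w}, w ∈ Ω → ContDiffAt ℝ 2 f w :=
    fun hf _ hw => hf.contDiffAt (hΩ.mem_nhds hw)
  have hd : ∀ {f : ℝ × ℝ → ℝ}, ContDiffOn ℝ 2 f Ω → ∀ {w}, w ∈ Ω → DifferentiableAt ℝ f w :=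
    fun hf _ hw => (hcd hf hw).differentiableAt (by norm_num)
  have hW : ∀ w ∈ Ω, DifferentiableAt ℝ (fun y => (u₀ y)⁻¹ * u y) w := fun w hw =>
    ((hd hu₀ hw).fun_inv (hu₀pos w hw).ne').fun_mul (hd hu hw)
  have hre : (fun w => (Φ w).re) =ᶠ[nhds z] fun w => (-1 / 2) *
      (u₀ w * (p w * fderiv ℝ u w (0, 1)) - u w * (p w * fderiv ℝ u₀ w (0, 1))) := by
    filter_upwards [hΩ.mem_nhds hz] with w hw
    rw [← mul_sq_mul_fderiv_inv_mul _ (hd hu₀ hw) (hd hu hw) (hu₀pos w hw).ne', hΦ, dzbar, pdx,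
      pdy, fderiv_cof_apply (hW w hw), fderiv_cof_apply (hW w hw)]
    simp [← Complex.ofReal_pow]
    ring
  have him : (fun w => (Φ w).im) =ᶠ[nhds z] fun w => (1 / 2) *
      (u₀ w * (p w * fderiv ℝ u w (1, 0)) - u w * (p w * fderiv ℝ u₀ w (1, 0))) := by
    filter_upwards [hΩ.mem_nhds hz] with w hw
    rw [← mul_sq_mul_fderiv_inv_mul _ (hd hu₀ hw) (hd hu hw) (hu₀pos w hw).ne', hΦ, dzbar, pdx,
      pdy, fderiv_cof_apply (hW w hw), fderiv_cof_apply (hW w hw)]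
    simp [← Complex.ofReal_pow]
    ring
  have h₀ := hu₀sol z hz
  have h₁ := husol z hz
  simp only [divPgrad, rpdx, rpdy] at h₀ h₁ ⊢
  rw [hre.fderiv_eq, him.fderiv_eq, fderiv_flux _ (hd hp hz) (hcd hu₀ hz) (hcd hu hz),
    fderiv_flux _ (hd hp hz) (hcd hu₀ hz) (hcd hu hz)]
  linear_combination (-1 / 2) * u₀ z * h₁ + (1 / 2) * u z * h₀
end

section
/- Let Ω = I × J ⊂ ℝ² be an open rectangle, let p and q be real-valued functions on Ω with p twice continuously differentiable and p > 0 on Ω, let u₀ be a positive twice continuously differentiable solution of div(p grad u₀) + q u₀ = 0 on Ω, set f = p^{1/2} u₀, and let u be a real-valued twice continuously differentiable solution of div(p grad u) + q u = 0 on Ω. Write i·p·u₀²·∂_z̄(u₀^{−1} u) = Φ₁ + iΦ₂ with Φ₁, Φ₂ real-valued, fix (x₀,y₀) ∈ Ω and c ∈ ℝ, and define v(x,y) = u₀(x,y)^{−1} · ( 2( ∫_{x₀}^{x} Φ₁(η,y) dη + ∫_{y₀}^{y} Φ₂(x₀,ξ) dξ ) + c ). Then the function W = p^{1/2} u + i p^{−1/2}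 v is a solution of the main Vekua equation ∂_z̄ W = (∂_z̄ f / f)·conj(W) on Ω, and v satisfies div((1/p) grad v) + q₁ v = 0 on Ω, where q₁ = −(1/p)( q/p + 2⟨∇p/p, ∇u₀/u₀⟩ + 2|∇u₀/u₀|² ). -/
open Complex

open Filter Topology Set

section PartialDerivatives

variable {f g : ℝ × ℝ → ℝ} {z : ℝ × ℝ}

lemma rpdx_congr (h : f =ᶠ[𝓝 z] g) : rpdx f z = rpdx g z := by
  simp only [rpdx, h.fderiv_eq]

lemma rpdy_congr (h : f =ᶠ[𝓝 z] g) : rpdy f z = rpdy g z := by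
  simp only [rpdy, h.fderiv_eq]

lemma rpdx_mul (hf : DifferentiableAt ℝ f z) (hg : DifferentiableAt ℝ g z) :
    rpdx (fun w => f w * g w) z = f z * rpdx g z + g z * rpdx f z := by
  simp [rpdx, fderiv_fun_mul hf hg]

lemma rpdy_mul (hf : DifferentiableAt ℝ f z) (hg : DifferentiableAt ℝ g z) :
    rpdy (fun w => f w * g w) z = f z * rpdy g z + g z * rpdy f z := by
  simp [rpdy, fderiv_fun_mul hf hg]

lemma rpdx_sub (hf : DifferentiableAt ℝ f z) (hg : DifferentiableAt ℝ g z) :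
    rpdx (fun w => f w - g w) z = rpdx f z - rpdx g z := by
  simp [rpdx, fderiv_fun_sub hf hg]

lemma rpdy_sub (hf : DifferentiableAt ℝ f z) (hg : DifferentiableAt ℝ g z) :
    rpdy (fun w => f w - g w) z = rpdy f z - rpdy g z := by
  simp [rpdy, fderiv_fun_sub hf hg]

lemma rpdx_const_mul (c : ℝ) (hf : DifferentiableAt ℝ f z) :
    rpdx (fun w => c * f w) z = c * rpdx f z := by
  simp [rpdx, fderiv_const_mul hf c]

lemma rpdy_const_mul (c : ℝ) (hf : DifferentiableAt ℝ f z) :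
    rpdy (fun w => c * f w) z = c * rpdy f z := by
  simp [rpdy, fderiv_const_mul hf c]

lemma rpdx_inv (hf : DifferentiableAt ℝ f z) (h0 : f z ≠ 0) :
    rpdx (fun w => (f w)⁻¹) z = -rpdx f z * ((f z)⁻¹) ^ 2 := by
  have := ((hasDerivAt_inv h0).comp_hasFDerivAt z hf.hasFDerivAt).fderiv
  simp only [Function.comp_def] at this
  simp [rpdx, this]
  ring

lemma rpdy_inv (hf : DifferentiableAt ℝ f z) (h0 : f z ≠ 0) :
    rpdy (fun w => (f w)⁻¹) z = -rpdy f z * ((f z)⁻¹) ^ 2 := by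
  have := ((hasDerivAt_inv h0).comp_hasFDerivAt z hf.hasFDerivAt).fderiv
  simp only [Function.comp_def] at this
  simp [rpdy, this]
  ring

lemma ContDiffAt.differentiableAt_rpdx (hf : ContDiffAt ℝ 2 f z) :
    DifferentiableAt ℝ (rpdx f) z :=
  ((hf.fderiv_right (m := 1) (by norm_num)).differentiableAt (by norm_num)).clm_apply
    (differentiableAt_const _)

lemma ContDiffAt.differentiableAt_rpdy (hf : ContDiffAt ℝ 2 f z) :
    DifferentiableAt ℝ (rpdy f) z :=
  ((hf.fderiv_right (m := 1) (by norm_num)).differentiableAt (by norm_num)).clm_apply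
    (differentiableAt_const _)

lemma ContDiffAt.rpdx_rpdy_comm (hf : ContDiffAt ℝ 2 f z) :
    rpdx (rpdy f) z = rpdy (rpdx f) z := by
  have hd := (hf.fderiv_right (m := 1) (by norm_num)).differentiableAt (by norm_num)
  have hs := (hf.isSymmSndFDerivAt (by simp)).eq (1, 0) (0, 1)
  have hx : fderiv ℝ (rpdx f) z (0, 1) = fderiv ℝ (fderiv ℝ f) z (0, 1) (1, 0) := by
    simp [fderiv_clm_apply hd (differentiableAt_const _),
      show rpdx f = fun w => fderiv ℝ f w (1, 0) from rfl]
  have hy : fderiv ℝ (rpdy f) z (1, 0) = fderiv ℝ (fderiv ℝ f) z (1, 0) (0, 1) := by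
    simp [fderiv_clm_apply hd (differentiableAt_const _),
      show rpdy f = fun w => fderiv ℝ f w (0, 1) from rfl]
  rw [rpdx, rpdy, hx, hy, hs]

lemma divPgrad_eq (hf : DifferentiableAt ℝ f z) (hg : ContDiffAt ℝ 2 g z) :
    divPgrad f g z = f z * rpdx (rpdx g) z + rpdx g z * rpdx f z
      + (f z * rpdy (rpdy g) z + rpdy g z * rpdy f z) := by
  rw [divPgrad, rpdx_mul hf hg.differentiableAt_rpdx, rpdy_mul hf hg.differentiableAt_rpdy]

lemma hasFDerivAt_cof (hf : DifferentiableAt ℝ f z) :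
    HasFDerivAt (cof f) (Complex.ofRealCLM.comp (fderiv ℝ f z)) z :=
  Complex.ofRealCLM.hasFDerivAt.comp z hf.hasFDerivAt

lemma dzbar_cof (hf : DifferentiableAt ℝ f z) :
    dzbar (cof f) z = 1 / 2 * ((rpdx f z : ℂ) + I * (rpdy f z : ℂ)) := by
  simp [dzbar, pdx, pdy, rpdx, rpdy, (hasFDerivAt_cof hf).fderiv]

lemma dzbar_cof_add_I_mul_cof (hf : DifferentiableAt ℝ f z) (hg : DifferentiableAt ℝ g z) :
    dzbar (fun w => cof f w + I * cof g w) z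
      = 1 / 2 * ((rpdx f z : ℂ) + I * rpdx g z + I * (rpdy f z + I * rpdy g z)) := by
  have h := ((hasFDerivAt_cof hf).add ((hasFDerivAt_cof hg).const_mul I)).fderiv
  simp only [Pi.add_def] at h
  simp [dzbar, pdx, pdy, rpdx, rpdy, h]

end PartialDerivatives

/-- A closed form `P dx + Q dy` on an open rectangle is the differential of the function obtained
by integrating it along a vertical and then a horizontal segment. -/
lemma hasFDerivAt_integral_add_integral {a₁ a₂ b₁ b₂ x₀ y₀ : ℝ} {P Q : ℝ × ℝ → ℝ}
    (hP : DifferentiableOn ℝ P (Ioo a₁ a₂ ×ˢ Ioo b₁ b₂))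
    (hQ : DifferentiableOn ℝ Q (Ioo a₁ a₂ ×ˢ Ioo b₁ b₂))
    (hPQ : ∀ z ∈ Ioo a₁ a₂ ×ˢ Ioo b₁ b₂, rpdy P z = rpdx Q z)
    (h₀ : (x₀, y₀) ∈ Ioo a₁ a₂ ×ˢ Ioo b₁ b₂) {z : ℝ × ℝ} (hz : z ∈ Ioo a₁ a₂ ×ˢ Ioo b₁ b₂) :
    HasFDerivAt (fun w : ℝ × ℝ => (∫ η in x₀..w.1, P (η, w.2)) + ∫ ξ in y₀..w.2, Q (x₀, ξ))
      (P z • ContinuousLinearMap.fst ℝ ℝ ℝ + Q z • ContinuousLinearMap.snd ℝ ℝ ℝ) z := by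
  have hΩ : IsOpen (Ioo a₁ a₂ ×ˢ Ioo b₁ b₂) := isOpen_Ioo.prod isOpen_Ioo
  have hconv : Convex ℝ (Ioo a₁ a₂ ×ˢ Ioo b₁ b₂) := (convex_Ioo a₁ a₂).prod (convex_Ioo b₁ b₂)
  obtain ⟨H, hH⟩ := hconv.exists_forall_hasFDerivAt_of_fderiv_symmetric hΩ
    (ω := fun w => P w • ContinuousLinearMap.fst ℝ ℝ ℝ + Q w • ContinuousLinearMap.snd ℝ ℝ ℝ)
    ((hP.smul_const _).add (hQ.smul_const _)) (by
      intro w hw s t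
      have hPw := hP.differentiableAt (hΩ.mem_nhds hw)
      have hQw := hQ.differentiableAt (hΩ.mem_nhds hw)
      have hd := ((hPw.hasFDerivAt.smul_const (ContinuousLinearMap.fst ℝ ℝ ℝ)).add
        (hQw.hasFDerivAt.smul_const (ContinuousLinearMap.snd ℝ ℝ ℝ))).fderiv
      simp only [Pi.add_def] at hd
      have hlin : ∀ (L : ℝ × ℝ →L[ℝ] ℝ) (r : ℝ × ℝ), L r = r.1 * L (1, 0) + r.2 * L (0, 1) := by
        intro L r
        conv_lhs => rw [show r = r.1 • ((1, 0) : ℝ × ℝ) + r.2 • ((0, 1) : ℝ × ℝ) by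
          ext <;> simp]
        rw [map_add, map_smul, map_smul, smul_eq_mul, smul_eq_mul]
      have hc := hPQ w hw
      simp only [rpdx, rpdy] at hc
      simp only [hd, add_apply, ContinuousLinearMap.smulRight_apply,
        smul_apply, ContinuousLinearMap.coe_fst', ContinuousLinearMap.coe_snd',
        smul_eq_mul]
      rw [hlin (fderiv ℝ P w) s, hlin (fderiv ℝ P w) t, hlin (fderiv ℝ Q w) s,
        hlin (fderiv ℝ Q w) t]
      linear_combination (s.2 * t.1 - t.2 * s.1) * hc)
  have hprim : ∀ w ∈ Ioo a₁ a₂ ×ˢ Ioo b₁ b₂,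
      (∫ η in x₀..w.1, P (η, w.2)) + ∫ ξ in y₀..w.2, Q (x₀, ξ) = H w - H (x₀, y₀) := by
    rintro ⟨x, y⟩ ⟨hx, hy⟩
    have hxs : ∀ η ∈ uIcc x₀ x, (η, y) ∈ Ioo a₁ a₂ ×ˢ Ioo b₁ b₂ := fun η hη =>
      ⟨ordConnected_Ioo.uIcc_subset h₀.1 hx hη, hy⟩
    have hys : ∀ ξ ∈ uIcc y₀ y, (x₀, ξ) ∈ Ioo a₁ a₂ ×ˢ Ioo b₁ b₂ := fun ξ hξ =>
      ⟨h₀.1, ordConnected_Ioo.uIcc_subset h₀.2 hy hξ⟩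
    have hx_int : ∫ η in x₀..x, P (η, y) = H (x, y) - H (x₀, y) := by
      refine intervalIntegral.integral_eq_sub_of_hasDerivAt (f := fun η => H (η, y))
        (fun η hη => ?_) (ContinuousOn.intervalIntegrable ?_)
      · have := (hH _ (hxs η hη)).comp_hasDerivAt η
          ((hasDerivAt_id η).prodMk (hasDerivAt_const η y))
        simpa [Function.comp_def] using this
      · exact hP.continuousOn.comp (by fun_prop) hxs
    have hy_int : ∫ ξ in y₀..y, Q (x₀, ξ) = H (x₀, y) - H (x₀, y₀) := by
      refine intervalIntegral.integral_eq_sub_of_hasDerivAt (f := fun ξ => H (x₀, ξ))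
        (fun ξ hξ => ?_) (ContinuousOn.intervalIntegrable ?_)
      · have := (hH _ (hys ξ hξ)).comp_hasDerivAt ξ
          ((hasDerivAt_const ξ x₀).prodMk (hasDerivAt_id ξ))
        simpa [Function.comp_def] using this
      · exact hQ.continuousOn.comp (by fun_prop) hys
    simp only [hx_int, hy_int]
    ring
  refine ((hH z hz).sub_const (H (x₀, y₀))).congr_of_eventuallyEq ?_
  filter_upwards [hΩ.mem_nhds hz] with w hw using hprim w hw

/-- on an open rectangle, given a solution `u` of `div(p grad u) + qu = 0`,
the conjugate metaharmonic function `v = u₀^{−1}·Ā[i p u₀² ∂_z̄(u₀^{−1}u)]` is such that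
`W = p^{1/2}u + i p^{−1/2}v` solves the main Vekua equation `∂_z̄ W = (∂_z̄ f/f)·conj W`
with `f = p^{1/2}u₀`, and `v` solves `div((1/p) grad v) + q₁ v = 0`. -/
theorem statement6 (a₁ a₂ b₁ b₂ : ℝ)
    (p q u₀ : ℝ × ℝ → ℝ)
    (hp : ContDiffOn ℝ 2 p (Set.Ioo a₁ a₂ ×ˢ Set.Ioo b₁ b₂))
    (hppos : ∀ z ∈ Set.Ioo a₁ a₂ ×ˢ Set.Ioo b₁ b₂, 0 < p z)
    (hu₀ : ContDiffOn ℝ 2 u₀ (Set.Ioo a₁ a₂ ×ˢ Set.Ioo b₁ b₂))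
    (hu₀pos : ∀ z ∈ Set.Ioo a₁ a₂ ×ˢ Set.Ioo b₁ b₂, 0 < u₀ z)
    (hu₀sol : ∀ z ∈ Set.Ioo a₁ a₂ ×ˢ Set.Ioo b₁ b₂, divPgrad p u₀ z + q z * u₀ z = 0)
    (f : ℝ × ℝ → ℝ) (hf : ∀ z, f z = Real.sqrt (p z) * u₀ z)
    (u : ℝ × ℝ → ℝ) (hu : ContDiffOn ℝ 2 u (Set.Ioo a₁ a₂ ×ˢ Set.Ioo b₁ b₂))
    (husol : ∀ z ∈ Set.Ioo a₁ a₂ ×ˢ Set.Ioo b₁ b₂, divPgrad p u z + q z * u z = 0)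
    (Φ₁ Φ₂ : ℝ × ℝ → ℝ)
    (hΦ : ∀ w, (Φ₁ w : ℂ) + Complex.I * (Φ₂ w : ℂ) =
      Complex.I * (p w : ℂ) * ((u₀ w : ℂ)) ^ 2 * dzbar (cof (fun v => (u₀ v)⁻¹ * u v)) w)
    (x₀ y₀ : ℝ) (h₀ : (x₀, y₀) ∈ Set.Ioo a₁ a₂ ×ˢ Set.Ioo b₁ b₂) (c : ℝ)
    (v : ℝ × ℝ → ℝ)
    (hv : ∀ x y : ℝ, v (x, y) = (u₀ (x, y))⁻¹ *
      (2 * ((∫ η in x₀..x, Φ₁ (η, y)) + ∫ ξ in y₀..y, Φ₂ (x₀, ξ)) + c))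
    (q₁ : ℝ × ℝ → ℝ)
    (hq₁ : ∀ z ∈ Set.Ioo a₁ a₂ ×ˢ Set.Ioo b₁ b₂,
      q₁ z = -(1 / p z) * (q z / p z +
        2 * (rpdx p z / p z * (rpdx u₀ z / u₀ z) + rpdy p z / p z * (rpdy u₀ z / u₀ z)) +
        2 * ((rpdx u₀ z / u₀ z) ^ 2 + (rpdy u₀ z / u₀ z) ^ 2)))
    (W : ℝ × ℝ → ℂ)
    (hW : ∀ z, W z = ((Real.sqrt (p z) * u z : ℝ) : ℂ) +
      Complex.I * (((Real.sqrt (p z))⁻¹ * v z : ℝ) : ℂ)) :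
    ∀ z ∈ Set.Ioo a₁ a₂ ×ˢ Set.Ioo b₁ b₂,
      dzbar W z = dzbar (cof f) z / (cof f z) * (starRingEnd ℂ) (W z) ∧
      divPgrad (fun w => (p w)⁻¹) v z + q₁ z * v z = 0 := by
  have hΩ : IsOpen (Ioo a₁ a₂ ×ˢ Ioo b₁ b₂) := isOpen_Ioo.prod isOpen_Ioo
  set Ω := Ioo a₁ a₂ ×ˢ Ioo b₁ b₂
  have hpC : ∀ w ∈ Ω, ContDiffAt ℝ 2 p w := fun w hw => hp.contDiffAt (hΩ.mem_nhds hw)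
  have hu₀C : ∀ w ∈ Ω, ContDiffAt ℝ 2 u₀ w := fun w hw => hu₀.contDiffAt (hΩ.mem_nhds hw)
  have huC : ∀ w ∈ Ω, ContDiffAt ℝ 2 u w := fun w hw => hu.contDiffAt (hΩ.mem_nhds hw)
  have hpD : ∀ w ∈ Ω, DifferentiableAt ℝ p w := fun w hw =>
    (hpC w hw).differentiableAt two_ne_zero
  have hu₀D : ∀ w ∈ Ω, DifferentiableAt ℝ u₀ w := fun w hw =>
    (hu₀C w hw).differentiableAt two_ne_zero
  have huD : ∀ w ∈ Ω, DifferentiableAt ℝ u w := fun w hw =>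
    (huC w hw).differentiableAt two_ne_zero
  have hkD : ∀ w ∈ Ω, DifferentiableAt ℝ (fun w => (u₀ w)⁻¹) w := fun w hw =>
    (hu₀D w hw).inv (hu₀pos w hw).ne'
  have hmD : ∀ w ∈ Ω, DifferentiableAt ℝ (fun w => (p w)⁻¹) w := fun w hw =>
    (hpD w hw).inv (hppos w hw).ne'
  -- the densities in closed form
  have hΦval : ∀ w ∈ Ω, Φ₁ w = -(1 / 2) * (p w * (u₀ w * rpdy u w - u w * rpdy u₀ w)) ∧
      Φ₂ w = 1 / 2 * (p w * (u₀ w * rpdx u w - u w * rpdx u₀ w)) := by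
    intro w hw
    have h0 := (hu₀pos w hw).ne'
    have h := hΦ w
    rw [dzbar_cof ((hkD w hw).fun_mul (huD w hw)), rpdx_mul (hkD w hw) (huD w hw),
      rpdy_mul (hkD w hw) (huD w hw), rpdx_inv (hu₀D w hw) h0, rpdy_inv (hu₀D w hw) h0] at h
    have h' : (Φ₁ w : ℂ) + I * (Φ₂ w : ℂ) =
        ((-(1 / 2) * (p w * (u₀ w * rpdy u w - u w * rpdy u₀ w)) : ℝ) : ℂ) +
        I * ((1 / 2 * (p w * (u₀ w * rpdx u w - u w * rpdx u₀ w)) : ℝ) : ℂ) := by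
      rw [h]
      have h0' : (u₀ w : ℂ) ≠ 0 := by exact_mod_cast h0
      push_cast
      field_simp
      linear_combination (p w : ℂ) * (u₀ w * rpdy u w - u w * rpdy u₀ w) * I_sq
    exact ⟨by simpa using congrArg re h', by simpa using congrArg im h'⟩
  have hAD : ∀ w ∈ Ω, DifferentiableAt ℝ
      (fun w => p w * (u₀ w * rpdy u w - u w * rpdy u₀ w)) w := fun w hw =>
    (hpD w hw).fun_mul (((hu₀D w hw).fun_mul (huC w hw).differentiableAt_rpdy).sub
      ((huD w hw).fun_mul (hu₀C w hw).differentiableAt_rpdy))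
  have hBD : ∀ w ∈ Ω, DifferentiableAt ℝ
      (fun w => p w * (u₀ w * rpdx u w - u w * rpdx u₀ w)) w := fun w hw =>
    (hpD w hw).fun_mul (((hu₀D w hw).fun_mul (huC w hw).differentiableAt_rpdx).sub
      ((huD w hw).fun_mul (hu₀C w hw).differentiableAt_rpdx))
  have hΦ₁eq : ∀ w ∈ Ω, Φ₁ =ᶠ[𝓝 w]
      fun w => -(1 / 2) * (p w * (u₀ w * rpdy u w - u w * rpdy u₀ w)) := fun w hw => by
    filter_upwards [hΩ.mem_nhds hw] with t ht using (hΦval t ht).1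
  have hΦ₂eq : ∀ w ∈ Ω, Φ₂ =ᶠ[𝓝 w]
      fun w => 1 / 2 * (p w * (u₀ w * rpdx u w - u w * rpdx u₀ w)) := fun w hw => by
    filter_upwards [hΩ.mem_nhds hw] with t ht using (hΦval t ht).2
  have hΦ₁D : DifferentiableOn ℝ Φ₁ Ω := fun w hw =>
    ((hΦ₁eq w hw).differentiableAt_iff.2 ((hAD w hw).const_mul _)).differentiableWithinAt
  have hΦ₂D : DifferentiableOn ℝ Φ₂ Ω := fun w hw =>
    ((hΦ₂eq w hw).differentiableAt_iff.2 ((hBD w hw).const_mul _)).differentiableWithinAt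
  have hclosed : ∀ w ∈ Ω, rpdy Φ₁ w = rpdx Φ₂ w := by
    intro w hw
    have hpw := hpD w hw
    have hu₀w := hu₀D w hw
    have huw := huD w hw
    have hux := (huC w hw).differentiableAt_rpdx
    have huy := (huC w hw).differentiableAt_rpdy
    have hu₀x := (hu₀C w hw).differentiableAt_rpdx
    have hu₀y := (hu₀C w hw).differentiableAt_rpdy
    have e := husol w hw
    have e₀ := hu₀sol w hw
    rw [divPgrad_eq hpw (huC w hw)] at e
    rw [divPgrad_eq hpw (hu₀C w hw)] at e₀
    rw [rpdy_congr (hΦ₁eq w hw), rpdx_congr (hΦ₂eq w hw), rpdy_const_mul _ (hAD w hw),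
      rpdx_const_mul _ (hBD w hw), rpdy_mul hpw ((hu₀w.fun_mul huy).fun_sub (huw.fun_mul hu₀y)),
      rpdx_mul hpw ((hu₀w.fun_mul hux).fun_sub (huw.fun_mul hu₀x)),
      rpdy_sub (hu₀w.fun_mul huy) (huw.fun_mul hu₀y), rpdx_sub (hu₀w.fun_mul hux) (huw.fun_mul hu₀x),
      rpdy_mul hu₀w huy, rpdy_mul huw hu₀y, rpdx_mul hu₀w hux, rpdx_mul huw hu₀x]
    linear_combination (-(1 / 2) * u₀ w) * e + (1 / 2 * u w) * e₀
  -- the potential `Y = u₀ v`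
  let Y : ℝ × ℝ → ℝ := fun w =>
    2 * ((∫ η in x₀..w.1, Φ₁ (η, w.2)) + ∫ ξ in y₀..w.2, Φ₂ (x₀, ξ)) + c
  have hvY : v = fun w => (u₀ w)⁻¹ * Y w := by
    ext ⟨x, y⟩
    exact hv x y
  have hYF : ∀ w ∈ Ω, HasFDerivAt Y ((2 : ℝ) •
      (Φ₁ w • ContinuousLinearMap.fst ℝ ℝ ℝ + Φ₂ w • ContinuousLinearMap.snd ℝ ℝ ℝ)) w :=
    fun w hw => ((hasFDerivAt_integral_add_integral hΦ₁D hΦ₂D hclosed h₀ hw).const_mul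
      2).add_const c
  have hYD : ∀ w ∈ Ω, DifferentiableAt ℝ Y w := fun w hw => (hYF w hw).differentiableAt
  have hYx : ∀ w ∈ Ω, rpdx Y w = -(p w * (u₀ w * rpdy u w - u w * rpdy u₀ w)) := by
    intro w hw
    simp only [rpdx, (hYF w hw).fderiv, (hΦval w hw).1]
    simp
  have hYy : ∀ w ∈ Ω, rpdy Y w = p w * (u₀ w * rpdx u w - u w * rpdx u₀ w) := by
    intro w hw
    simp only [rpdy, (hYF w hw).fderiv, (hΦval w hw).2]
    simp
  have hvx : ∀ w ∈ Ω, rpdx v w = -(p w * (rpdy u w - (u₀ w)⁻¹ * (u w * rpdy u₀ w))) -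
      (u₀ w)⁻¹ ^ 2 * (rpdx u₀ w * Y w) := by
    intro w hw
    have h0 := (hu₀pos w hw).ne'
    rw [hvY, rpdx_mul (hkD w hw) (hYD w hw), hYx w hw, rpdx_inv (hu₀D w hw) h0]
    field_simp
    ring
  have hvy : ∀ w ∈ Ω, rpdy v w = p w * (rpdx u w - (u₀ w)⁻¹ * (u w * rpdx u₀ w)) -
      (u₀ w)⁻¹ ^ 2 * (rpdy u₀ w * Y w) := by
    intro w hw
    have h0 := (hu₀pos w hw).ne'
    rw [hvY, rpdy_mul (hkD w hw) (hYD w hw), hYy w hw, rpdy_inv (hu₀D w hw) h0]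
    field_simp
    ring
  intro z hz
  have hpz := hpD z hz
  have hu₀z := hu₀D z hz
  have huz := huD z hz
  have hkz := hkD z hz
  have hmz := hmD z hz
  have hYz := hYD z hz
  have hvz : DifferentiableAt ℝ v z := hvY ▸ hkz.fun_mul hYz
  have hp0 := (hppos z hz).ne'
  have h0 := (hu₀pos z hz).ne'
  refine ⟨?_, ?_⟩
  · have hsz : DifferentiableAt ℝ (fun w => √(p w)) z := hpz.sqrt hp0
    have hs0 : √(p z) ≠ 0 := (Real.sqrt_pos.2 (hppos z hz)).ne'
    have hsp : (p z : ℂ) = (√(p z) : ℂ) ^ 2 := by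
      exact_mod_cast (Real.sq_sqrt (hppos z hz).le).symm
    have hsiz : DifferentiableAt ℝ (fun w => (√(p w))⁻¹) z := hsz.inv hs0
    have hWf : W = fun w => cof (fun w => √(p w) * u w) w +
        I * cof (fun w => (√(p w))⁻¹ * v w) w := funext hW
    have hff : f = fun w => √(p w) * u₀ w := funext hf
    have hvz_val : v z = (u₀ z)⁻¹ * Y z := congrFun hvY z
    rw [hW z, hWf, hff, dzbar_cof_add_I_mul_cof (hsz.fun_mul huz) (hsiz.fun_mul hvz),
      dzbar_cof (hsz.fun_mul hu₀z), rpdx_mul hsz huz, rpdy_mul hsz huz, rpdx_mul hsiz hvz,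
      rpdy_mul hsiz hvz, rpdx_mul hsz hu₀z, rpdy_mul hsz hu₀z, rpdx_inv hsz hs0,
      rpdy_inv hsz hs0, hvx z hz, hvy z hz, hvz_val]
    have hs0' : (√(p z) : ℂ) ≠ 0 := by exact_mod_cast hs0
    have h0' : (u₀ z : ℂ) ≠ 0 := by exact_mod_cast h0
    simp only [cof, map_add, map_mul, conj_I, conj_ofReal]
    push_cast
    rw [hsp]
    generalize (√(p z) : ℂ) = s at *
    field_simp
    ring_nf
    simp only [I_sq]
    ring
  · have hux := (huC z hz).differentiableAt_rpdx
    have huy := (huC z hz).differentiableAt_rpdy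
    have hu₀x := (hu₀C z hz).differentiableAt_rpdx
    have hu₀y := (hu₀C z hz).differentiableAt_rpdy
    have hflux_x : (fun w => (p w)⁻¹ * rpdx v w) =ᶠ[𝓝 z] fun w =>
        ((u₀ w)⁻¹ * (u w * rpdy u₀ w) - rpdy u w) -
          (p w)⁻¹ * (((u₀ w)⁻¹ * (u₀ w)⁻¹) * (rpdx u₀ w * Y w)) := by
      filter_upwards [hΩ.mem_nhds hz] with w hw
      have := (hppos w hw).ne'
      rw [hvx w hw]
      field_simp
      ring
    have hflux_y : (fun w => (p w)⁻¹ * rpdy v w) =ᶠ[𝓝 z] fun w =>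
        (rpdx u w - (u₀ w)⁻¹ * (u w * rpdx u₀ w)) -
          (p w)⁻¹ * (((u₀ w)⁻¹ * (u₀ w)⁻¹) * (rpdy u₀ w * Y w)) := by
      filter_upwards [hΩ.mem_nhds hz] with w hw
      have := (hppos w hw).ne'
      rw [hvy w hw]
      field_simp
    have e₀ := hu₀sol z hz
    rw [divPgrad_eq hpz (hu₀C z hz)] at e₀
    have hsymm := (huC z hz).rpdx_rpdy_comm
    have hsymm₀ := (hu₀C z hz).rpdx_rpdy_comm
    rw [divPgrad, rpdx_congr hflux_x, rpdy_congr hflux_y,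
      rpdx_sub ((hkz.fun_mul (huz.fun_mul hu₀y)).fun_sub huy) (hmz.fun_mul ((hkz.fun_mul hkz).fun_mul (hu₀x.fun_mul hYz))),
      rpdy_sub (hux.fun_sub (hkz.fun_mul (huz.fun_mul hu₀x))) (hmz.fun_mul ((hkz.fun_mul hkz).fun_mul (hu₀y.fun_mul hYz))),
      rpdx_sub (hkz.fun_mul (huz.fun_mul hu₀y)) huy, rpdy_sub hux (hkz.fun_mul (huz.fun_mul hu₀x)),
      rpdx_mul hkz (huz.fun_mul hu₀y), rpdx_mul huz hu₀y,
      rpdy_mul hkz (huz.fun_mul hu₀x), rpdy_mul huz hu₀x,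
      rpdx_mul hmz ((hkz.fun_mul hkz).fun_mul (hu₀x.fun_mul hYz)),
      rpdx_mul (hkz.fun_mul hkz) (hu₀x.fun_mul hYz), rpdx_mul hkz hkz, rpdx_mul hu₀x hYz,
      rpdy_mul hmz ((hkz.fun_mul hkz).fun_mul (hu₀y.fun_mul hYz)),
      rpdy_mul (hkz.fun_mul hkz) (hu₀y.fun_mul hYz), rpdy_mul hkz hkz, rpdy_mul hu₀y hYz,
      rpdx_inv hpz hp0, rpdy_inv hpz hp0, rpdx_inv hu₀z h0, rpdy_inv hu₀z h0,
      hYx z hz, hYy z hz, hq₁ z hz, congrFun hvY z, hsymm, hsymm₀]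
    field_simp
    linear_combination (-Y z * u₀ z) * e₀
end

section
/- Let Ω ⊂ ℝ² be open and let F, G, F₁, G₁ : Ω → ℂ be twice continuously differentiable complex-valued functions with Im(conj(F)·G) > 0 and Im(conj(F₁)·G₁) > 0 on Ω. Suppose (F₁,G₁) is a successor of (F,G), i.e. a_{(F₁,G₁)} = a_{(F,G)} and b_{(F₁,G₁)} = −B_{(F,G)} on Ω. Let W : Ω → ℂ be twice continuously differentiable and (F,G)-pseudoanalytic, i.e. ∂_z̄ W = a_{(F,G)}·W + b_{(F,G)}·conj(W) on Ω. Then the (F,G)-derivative Ẇ = ∂_z W − A_{(F,G)}·W − B_{(F,G)}·conj(W) is (F₁,G₁)-pseudoanalytic, i.e. ∂_z̄ Ẇ = a_{(F₁,G₁)}·Ẇ + b_{(F₁,G₁)}·conj(Ẇ) on Ω. -/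
open Complex

/-- Characteristic coefficient `a_{(F,G)}`. -/
noncomputable def charA (F G : ℝ × ℝ → ℂ) (z : ℝ × ℝ) : ℂ :=
  -((starRingEnd ℂ) (F z) * dzbar G z - dzbar F z * (starRingEnd ℂ) (G z)) /
    (F z * (starRingEnd ℂ) (G z) - (starRingEnd ℂ) (F z) * G z)

/-- Characteristic coefficient `b_{(F,G)}`. -/
noncomputable def charB (F G : ℝ × ℝ → ℂ) (z : ℝ × ℝ) : ℂ :=
  (F z * dzbar G z - dzbar F z * G z) /
    (F z * (starRingEnd ℂ) (G z) - (starRingEnd ℂ) (F z) * G z)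

/-- Characteristic coefficient `A_{(F,G)}`. -/
noncomputable def charBigA (F G : ℝ × ℝ → ℂ) (z : ℝ × ℝ) : ℂ :=
  -((starRingEnd ℂ) (F z) * dz G z - dz F z * (starRingEnd ℂ) (G z)) /
    (F z * (starRingEnd ℂ) (G z) - (starRingEnd ℂ) (F z) * G z)

/-- Characteristic coefficient `B_{(F,G)}`. -/
noncomputable def charBigB (F G : ℝ × ℝ → ℂ) (z : ℝ × ℝ) : ℂ :=
  (F z * dz G z - dz F z * G z) /
    (F z * (starRingEnd ℂ) (G z) - (starRingEnd ℂ) (F z) * G z)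

section Wirtinger

variable {f g : ℝ × ℝ → ℂ} {z : ℝ × ℝ}

lemma dz_add (hf : DifferentiableAt ℝ f z) (hg : DifferentiableAt ℝ g z) :
    dz (fun w => f w + g w) z = dz f z + dz g z := by
  simp only [dz, pdx, pdy, fderiv_fun_add hf hg, add_apply]
  ring

lemma dzbar_add (hf : DifferentiableAt ℝ f z) (hg : DifferentiableAt ℝ g z) :
    dzbar (fun w => f w + g w) z = dzbar f z + dzbar g z := by
  simp only [dzbar, pdx, pdy, fderiv_fun_add hf hg, add_apply]
  ring

lemma dz_mul (hf : DifferentiableAt ℝ f z) (hg : DifferentiableAt ℝ g z) :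
    dz (fun w => f w * g w) z = dz f z * g z + f z * dz g z := by
  simp only [dz, pdx, pdy, fderiv_fun_mul hf hg, add_apply, smul_apply, smul_eq_mul]
  ring

lemma dzbar_mul (hf : DifferentiableAt ℝ f z) (hg : DifferentiableAt ℝ g z) :
    dzbar (fun w => f w * g w) z = dzbar f z * g z + f z * dzbar g z := by
  simp only [dzbar, pdx, pdy, fderiv_fun_mul hf hg, add_apply, smul_apply, smul_eq_mul]
  ring

lemma dz_congr (h : f =ᶠ[nhds z] g) : dz f z = dz g z := by
  simp only [dz, pdx, pdy, h.fderiv_eq]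

lemma dzbar_congr (h : f =ᶠ[nhds z] g) : dzbar f z = dzbar g z := by
  simp only [dzbar, pdx, pdy, h.fderiv_eq]

lemma dz_zero : dz (fun _ => 0) z = 0 := by
  simp [dz, pdx, pdy]

lemma dz_conj (hf : DifferentiableAt ℝ f z) :
    dz (fun w => (starRingEnd ℂ) (f w)) z = (starRingEnd ℂ) (dzbar f z) := by
  have h : fderiv ℝ (fun w => (starRingEnd ℂ) (f w)) z =
      (Complex.conjCLE : ℂ →L[ℝ] ℂ).comp (fderiv ℝ f z) :=
    ((Complex.conjCLE : ℂ →L[ℝ] ℂ).hasFDerivAt.comp z hf.hasFDerivAt).fderiv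
  have h2 : (starRingEnd ℂ) 2 = 2 := Complex.conj_ofNat 2
  simp [dz, dzbar, pdx, pdy, h, h2, sub_eq_add_neg]

lemma differentiableAt_fderiv_apply (hf : ContDiffAt ℝ 2 f z) (v : ℝ × ℝ) :
    DifferentiableAt ℝ (fun w => fderiv ℝ f w v) z :=
  ((hf.fderiv_right (m := 1) (by norm_num)).differentiableAt (by norm_num)).clm_apply
    (differentiableAt_const v)

lemma fderiv_fderiv_apply (hf : ContDiffAt ℝ 2 f z) (u v : ℝ × ℝ) :
    fderiv ℝ (fun w => fderiv ℝ f w v) z u = fderiv ℝ (fderiv ℝ f) z u v := by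
  have h : DifferentiableAt ℝ (fderiv ℝ f) z :=
    (hf.fderiv_right (m := 1) (by norm_num)).differentiableAt (by norm_num)
  rw [fderiv_clm_apply h (differentiableAt_const v)]
  simp

lemma differentiableAt_dz (hf : ContDiffAt ℝ 2 f z) : DifferentiableAt ℝ (dz f) z :=
  ((differentiableAt_fderiv_apply hf (1, 0)).sub
    ((differentiableAt_fderiv_apply hf (0, 1)).const_mul Complex.I)).const_mul (1 / 2 : ℂ)

lemma differentiableAt_dzbar (hf : ContDiffAt ℝ 2 f z) : DifferentiableAt ℝ (dzbar f) z :=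
  ((differentiableAt_fderiv_apply hf (1, 0)).add
    ((differentiableAt_fderiv_apply hf (0, 1)).const_mul Complex.I)).const_mul (1 / 2 : ℂ)

lemma fderiv_dz_apply (hf : ContDiffAt ℝ 2 f z) (u : ℝ × ℝ) :
    fderiv ℝ (dz f) z u = (1 / 2 : ℂ) * (fderiv ℝ (fderiv ℝ f) z u (1, 0) -
      Complex.I * fderiv ℝ (fderiv ℝ f) z u (0, 1)) := by
  have hx := differentiableAt_fderiv_apply hf (1, 0)
  have hy := differentiableAt_fderiv_apply hf (0, 1)
  rw [← fderiv_fderiv_apply hf, ← fderiv_fderiv_apply hf]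
  change fderiv ℝ (fun w => (1 / 2 : ℂ) *
    (fderiv ℝ f w (1, 0) - Complex.I * fderiv ℝ f w (0, 1))) z u = _
  rw [fderiv_const_mul (hx.fun_sub (hy.const_mul _)), fderiv_fun_sub hx (hy.const_mul _),
    fderiv_const_mul hy]
  simp

lemma fderiv_dzbar_apply (hf : ContDiffAt ℝ 2 f z) (u : ℝ × ℝ) :
    fderiv ℝ (dzbar f) z u = (1 / 2 : ℂ) * (fderiv ℝ (fderiv ℝ f) z u (1, 0) +
      Complex.I * fderiv ℝ (fderiv ℝ f) z u (0, 1)) := by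
  have hx := differentiableAt_fderiv_apply hf (1, 0)
  have hy := differentiableAt_fderiv_apply hf (0, 1)
  rw [← fderiv_fderiv_apply hf, ← fderiv_fderiv_apply hf]
  change fderiv ℝ (fun w => (1 / 2 : ℂ) *
    (fderiv ℝ f w (1, 0) + Complex.I * fderiv ℝ f w (0, 1))) z u = _
  rw [fderiv_const_mul (hx.fun_add (hy.const_mul _)), fderiv_fun_add hx (hy.const_mul _),
    fderiv_const_mul hy]
  simp [mul_add]

lemma dz_dzbar_comm (hf : ContDiffAt ℝ 2 f z) : dz (dzbar f) z = dzbar (dz f) z := by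
  have hsymm : fderiv ℝ (fderiv ℝ f) z (1, 0) (0, 1) = fderiv ℝ (fderiv ℝ f) z (0, 1) (1, 0) :=
    (hf.isSymmSndFDerivAt (by simp)).eq _ _
  rw [dz, dzbar, pdx, pdy, pdx, pdy]
  simp only [fderiv_dz_apply hf, fderiv_dzbar_apply hf, hsymm]
  ring

end Wirtinger

section GeneratingPair

variable {F G : ℝ × ℝ → ℂ} {z : ℝ × ℝ}

lemma generatingPair_denom_ne_zero (h : 0 < ((starRingEnd ℂ) (F z) * G z).im) :
    F z * (starRingEnd ℂ) (G z) - (starRingEnd ℂ) (F z) * G z ≠ 0 := by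
  intro h0
  have him := congrArg Complex.im h0
  simp at him h
  linarith

lemma dzbar_fst_eq
    (hD : F z * (starRingEnd ℂ) (G z) - (starRingEnd ℂ) (F z) * G z ≠ 0) :
    dzbar F z = charA F G z * F z + charB F G z * (starRingEnd ℂ) (F z) := by
  rw [charA, charB, div_mul_eq_mul_div, div_mul_eq_mul_div, ← add_div, eq_div_iff hD]
  ring

lemma dzbar_snd_eq
    (hD : F z * (starRingEnd ℂ) (G z) - (starRingEnd ℂ) (F z) * G z ≠ 0) :
    dzbar G z = charA F G z * G z + charB F G z * (starRingEnd ℂ) (G z) := by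
  rw [charA, charB, div_mul_eq_mul_div, div_mul_eq_mul_div, ← add_div, eq_div_iff hD]
  ring

lemma dz_fst_eq
    (hD : F z * (starRingEnd ℂ) (G z) - (starRingEnd ℂ) (F z) * G z ≠ 0) :
    dz F z = charBigA F G z * F z + charBigB F G z * (starRingEnd ℂ) (F z) := by
  rw [charBigA, charBigB, div_mul_eq_mul_div, div_mul_eq_mul_div, ← add_div, eq_div_iff hD]
  ring

lemma dz_snd_eq
    (hD : F z * (starRingEnd ℂ) (G z) - (starRingEnd ℂ) (F z) * G z ≠ 0) :
    dz G z = charBigA F G z * G z + charBigB F G z * (starRingEnd ℂ) (G z) := by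
  rw [charBigA, charBigB, div_mul_eq_mul_div, div_mul_eq_mul_div, ← add_div, eq_div_iff hD]
  ring

end GeneratingPair

/-- A function is a combination of a generating pair with real-valued coefficients,
which inherit its regularity. -/
lemma exists_real_coefficients {Ω : Set (ℝ × ℝ)} {F G W : ℝ × ℝ → ℂ} {n : WithTop ℕ∞}
    (hF : ContDiffOn ℝ n F Ω) (hG : ContDiffOn ℝ n G Ω) (hW : ContDiffOn ℝ n W Ω)
    (hD : ∀ z ∈ Ω, F z * (starRingEnd ℂ) (G z) - (starRingEnd ℂ) (F z) * G z ≠ 0) :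
    ∃ φ ψ : ℝ × ℝ → ℂ, ContDiffOn ℝ n φ Ω ∧ ContDiffOn ℝ n ψ Ω ∧
      (∀ z, (starRingEnd ℂ) (φ z) = φ z) ∧ (∀ z, (starRingEnd ℂ) (ψ z) = ψ z) ∧
      ∀ z ∈ Ω, W z = φ z * F z + ψ z * G z := by
  have hconj {f : ℝ × ℝ → ℂ} (hf : ContDiffOn ℝ n f Ω) :
      ContDiffOn ℝ n (fun w => (starRingEnd ℂ) (f w)) Ω :=
    (Complex.conjCLE : ℂ →L[ℝ] ℂ).contDiff.comp_contDiffOn hf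
  have hDc := (hF.mul (hconj hG)).sub ((hconj hF).mul hG)
  refine ⟨fun w => (W w * (starRingEnd ℂ) (G w) - (starRingEnd ℂ) (W w) * G w) *
      (F w * (starRingEnd ℂ) (G w) - (starRingEnd ℂ) (F w) * G w)⁻¹,
    fun w => (F w * (starRingEnd ℂ) (W w) - (starRingEnd ℂ) (F w) * W w) *
      (F w * (starRingEnd ℂ) (G w) - (starRingEnd ℂ) (F w) * G w)⁻¹,
    ((hW.mul (hconj hG)).sub ((hconj hW).mul hG)).mul (hDc.inv hD),
    ((hF.mul (hconj hW)).sub ((hconj hF).mul hW)).mul (hDc.inv hD), ?_, ?_, ?_⟩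
  · intro z
    simp only [map_mul, map_sub, map_inv₀, Complex.conj_conj]
    rw [← neg_sub (F z * _), inv_neg]
    ring
  · intro z
    simp only [map_mul, map_sub, map_inv₀, Complex.conj_conj]
    rw [← neg_sub (F z * (starRingEnd ℂ) (G z)), inv_neg]
    ring
  · intro z hz
    linear_combination -W z * mul_inv_cancel₀ (hD z hz)

/-- Bers: if `(F₁,G₁)` is a successor of `(F,G)` and `W` is
`(F,G)`-pseudoanalytic, then the `(F,G)`-derivative
`Ẇ = ∂_z W − A_{(F,G)}W − B_{(F,G)}·conj W` is `(F₁,G₁)`-pseudoanalytic. -/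
theorem statement11 (Ω : Set (ℝ × ℝ)) (hΩ : IsOpen Ω)
    (F G F₁ G₁ : ℝ × ℝ → ℂ)
    (hF : ContDiffOn ℝ 2 F Ω) (hG : ContDiffOn ℝ 2 G Ω)
    (hF₁ : ContDiffOn ℝ 2 F₁ Ω) (hG₁ : ContDiffOn ℝ 2 G₁ Ω)
    (hFG : ∀ z ∈ Ω, 0 < ((starRingEnd ℂ) (F z) * G z).im)
    (hF₁G₁ : ∀ z ∈ Ω, 0 < ((starRingEnd ℂ) (F₁ z) * G₁ z).im)
    (hsucc_a : ∀ z ∈ Ω, charA F₁ G₁ z = charA F G z)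
    (hsucc_b : ∀ z ∈ Ω, charB F₁ G₁ z = -charBigB F G z)
    (W : ℝ × ℝ → ℂ) (hW : ContDiffOn ℝ 2 W Ω)
    (hWpseudo : ∀ z ∈ Ω,
      dzbar W z = charA F G z * W z + charB F G z * (starRingEnd ℂ) (W z)) :
    ∀ z ∈ Ω,
      dzbar (fun w => dz W w - charBigA F G w * W w -
          charBigB F G w * (starRingEnd ℂ) (W w)) z =
        charA F₁ G₁ z *
            (dz W z - charBigA F G z * W z - charBigB F G z * (starRingEnd ℂ) (W z)) +
          charB F₁ G₁ z * (starRingEnd ℂ)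
            (dz W z - charBigA F G z * W z - charBigB F G z * (starRingEnd ℂ) (W z)) := by
  have hD z (hz : z ∈ Ω) := generatingPair_denom_ne_zero (hFG z hz)
  obtain ⟨φ, ψ, hφ, hψ, hφr, hψr, hWeq⟩ := exists_real_coefficients hF hG hW hD
  have hat {f : ℝ × ℝ → ℂ} (hf : ContDiffOn ℝ 2 f Ω) {z} (hz : z ∈ Ω) : ContDiffAt ℝ 2 f z :=
    hf.contDiffAt (hΩ.mem_nhds hz)
  have hdiff {f : ℝ × ℝ → ℂ} (hf : ContDiffOn ℝ 2 f Ω) {z} (hz : z ∈ Ω) :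
      DifferentiableAt ℝ f z := (hat hf hz).differentiableAt (by norm_num)
  have hreal {f : ℝ × ℝ → ℂ} (hf : ContDiffOn ℝ 2 f Ω) (hr : ∀ z, (starRingEnd ℂ) (f z) = f z)
      {z} (hz : z ∈ Ω) : dz f z = (starRingEnd ℂ) (dzbar f z) := by
    rw [← dz_conj (hdiff hf hz), funext hr]
  have hWev z (hz : z ∈ Ω) : W =ᶠ[nhds z] fun w => φ w * F w + ψ w * G w :=
    Filter.eventually_of_mem (hΩ.mem_nhds hz) hWeq
  have hWconj z (hz : z ∈ Ω) : (starRingEnd ℂ) (W z) =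
      φ z * (starRingEnd ℂ) (F z) + ψ z * (starRingEnd ℂ) (G z) := by
    rw [hWeq z hz, map_add, map_mul, map_mul, hφr, hψr]
  have hzero z (hz : z ∈ Ω) : dzbar φ z * F z + dzbar ψ z * G z = 0 := by
    have h := hWpseudo z hz
    rw [dzbar_congr (hWev z hz), dzbar_add ((hdiff hφ hz).fun_mul (hdiff hF hz))
      ((hdiff hψ hz).fun_mul (hdiff hG hz)), dzbar_mul (hdiff hφ hz) (hdiff hF hz),
      dzbar_mul (hdiff hψ hz) (hdiff hG hz), hWconj z hz, hWeq z hz] at h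
    linear_combination h - φ z * dzbar_fst_eq (hD z hz) - ψ z * dzbar_snd_eq (hD z hz)
  have hdot z (hz : z ∈ Ω) :
      dz W z - charBigA F G z * W z - charBigB F G z * (starRingEnd ℂ) (W z) =
        dz φ z * F z + dz ψ z * G z := by
    rw [dz_congr (hWev z hz), dz_add ((hdiff hφ hz).fun_mul (hdiff hF hz))
      ((hdiff hψ hz).fun_mul (hdiff hG hz)), dz_mul (hdiff hφ hz) (hdiff hF hz),
      dz_mul (hdiff hψ hz) (hdiff hG hz), hWconj z hz, hWeq z hz]
    linear_combination φ z * dz_fst_eq (hD z hz) + ψ z * dz_snd_eq (hD z hz)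
  intro z hz
  have hφz := differentiableAt_dz (hat hφ hz)
  have hψz := differentiableAt_dz (hat hψ hz)
  have hφb := differentiableAt_dzbar (hat hφ hz)
  have hψb := differentiableAt_dzbar (hat hψ hz)
  have hFz := hdiff hF hz
  have hGz := hdiff hG hz
  have hzero' : dz (fun w => dzbar φ w * F w + dzbar ψ w * G w) z = 0 :=
    (dz_congr (Filter.eventually_of_mem (hΩ.mem_nhds hz) hzero)).trans dz_zero
  rw [dz_add (hφb.fun_mul hFz) (hψb.fun_mul hGz), dz_mul hφb hFz, dz_mul hψb hGz,
    dz_dzbar_comm (hat hφ hz), dz_dzbar_comm (hat hψ hz)] at hzero'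
  have hzeroc := congrArg (starRingEnd ℂ) (hzero z hz)
  rw [map_add, map_mul, map_mul, ← hreal hφ hφr hz, ← hreal hψ hψr hz, map_zero] at hzeroc
  rw [dzbar_congr (Filter.eventually_of_mem (hΩ.mem_nhds hz) hdot), hdot z hz,
    dzbar_add (hφz.fun_mul hFz) (hψz.fun_mul hGz), dzbar_mul hφz hFz, dzbar_mul hψz hGz,
    hsucc_a z hz, hsucc_b z hz, map_add, map_mul, map_mul, hreal hφ hφr hz, hreal hψ hψr hz,
    Complex.conj_conj, Complex.conj_conj, ← hreal hφ hφr hz, ← hreal hψ hψr hz]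
  linear_combination hzero' + dz φ z * dzbar_fst_eq (hD z hz) + dz ψ z * dzbar_snd_eq (hD z hz)
    - dzbar φ z * dz_fst_eq (hD z hz) - dzbar ψ z * dz_snd_eq (hD z hz)
    + charB F G z * hzeroc - charBigA F G z * hzero z hz
end
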